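/- arXiv:1307.6390 — 2 statements merged into one kernel-verified Lean document; each statement's English description precedes it below -/
import Mathlib

section
/- For every real α ≥ 1, every i,j ∈ {1,2}, and every choice of tripartite quantum state ρ and ±1-valued local observables A_1, A_2, B_1, B_2, C_1, C_2 as in the context: (Ĩ^α_{AB})² + 4·⟨A_iC_j⟩² ≤ 4·(1 + α²). -/
open Kronecker ComplexOrder

/-- The correlator `⟨A ⊗ B ⊗ 1⟩_ρ = Re Tr[ρ·(A ⊗ B ⊗ 1)]` of observables of the first two
parties in a tripartite state `ρ` (tensor products as Kronecker products). -/
noncomputable def corrAB {nA nB nC : ℕ}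
    (ρ : Matrix ((Fin nA × Fin nB) × Fin nC) ((Fin nA × Fin nB) × Fin nC) ℂ)
    (A : Matrix (Fin nA) (Fin nA) ℂ) (B : Matrix (Fin nB) (Fin nB) ℂ) : ℝ :=
  ((ρ * ((A ⊗ₖ B) ⊗ₖ (1 : Matrix (Fin nC) (Fin nC) ℂ))).trace).re

/-- The correlator `⟨A ⊗ 1 ⊗ C⟩_ρ = Re Tr[ρ·(A ⊗ 1 ⊗ C)]` of observables of the first and
third parties in a tripartite state `ρ`. -/
noncomputable def corrAC {nA nB nC : ℕ}
    (ρ : Matrix ((Fin nA × Fin nB) × Fin nC) ((Fin nA × Fin nB) × Fin nC) ℂ)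
    (A : Matrix (Fin nA) (Fin nA) ℂ) (C : Matrix (Fin nC) (Fin nC) ℂ) : ℝ :=
  ((ρ * ((A ⊗ₖ (1 : Matrix (Fin nB) (Fin nB) ℂ)) ⊗ₖ C)).trace).re

/-- The tilted CHSH expression
`Ĩ^α = α(⟨X_1Y_1⟩ + ⟨X_1Y_2⟩) + ⟨X_2Y_1⟩ − ⟨X_2Y_2⟩` built from four correlators. -/
noncomputable def tiltedCHSH (α : ℝ) (c : Fin 2 → Fin 2 → ℝ) : ℝ :=
  α * (c 0 0 + c 0 1) + c 1 0 - c 1 1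

open Matrix MatrixOrder in
/-- The trace of a product of two positive semidefinite matrices is nonnegative. -/
theorem Matrix.PosSemidef.re_trace_mul_nonneg {n : Type*} [Fintype n] [DecidableEq n]
    {P Q : Matrix n n ℂ} (hP : P.PosSemidef) (hQ : Q.PosSemidef) : 0 ≤ (P * Q).trace.re := by
  obtain ⟨R, rfl⟩ := CStarAlgebra.nonneg_iff_eq_star_mul_self.mp hP.nonneg
  have h := (hQ.mul_mul_conjTranspose_same R).trace_nonneg
  rw [star_eq_conjTranspose, mul_assoc, trace_mul_comm]
  exact (Complex.le_def.mp h).1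

open Matrix in
/-- If `N` is positive definite and commutes with the Hermitian matrix `F`, then `F² ≤ N²`
implies `F ≤ N`. -/
theorem Matrix.PosDef.posSemidef_sub_of_sq {n : Type*} [Fintype n] [DecidableEq n]
    {N F : Matrix n n ℂ} (hN : N.PosDef) (hF : F.IsHermitian) (hNF : Commute N F)
    (h : (N * N - F * F).PosSemidef) : (N - F).PosSemidef := by
  have hH : (N - F).IsHermitian := hN.isHermitian.sub hF
  rw [hH.posSemidef_iff_eigenvalues_nonneg]
  intro j
  have hP : (2 * (N * (N - F))).PosSemidef := by
    convert (posSemidef_conjTranspose_mul_self (N - F)).add h using 1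
    rw [hH.eq, mul_sub, sub_mul, mul_sub, mul_sub, hNF.eq]
    noncomm_ring
  set x : n → ℂ := ⇑(hH.eigenvectorBasis j) with hx
  have hx0 : x ≠ 0 := by
    intro h0
    apply hH.eigenvectorBasis.toBasis.ne_zero j
    ext i
    simpa using congrFun h0 i
  have hpos := hN.dotProduct_mulVec_pos hx0
  have hnn := hP.dotProduct_mulVec_nonneg x
  have hev : (2 * (N * (N - F))) *ᵥ x = ((2 * hH.eigenvalues j : ℝ) : ℂ) • (N *ᵥ x) := by
    rw [two_mul, add_mulVec, ← mulVec_mulVec, hx, hH.mulVec_eigenvectorBasis, mulVec_smul,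
      ← two_smul ℂ, RCLike.real_smul_eq_coe_smul (K := ℂ), smul_smul]
    simp
  rw [hev, dotProduct_smul, smul_eq_mul] at hnn
  have h1 := (Complex.le_def.mp hnn).1
  have h2 := (Complex.lt_def.mp hpos).1
  rw [Complex.re_ofReal_mul] at h1
  simp only [Complex.zero_re] at h1 h2
  show 0 ≤ hH.eigenvalues j
  nlinarith [nonneg_of_mul_nonneg_left h1 h2]

set_option linter.unusedSimpArgs false in
open Matrix in
/-- Criterion for a three-party Bell operator to have square at most `k`. The square of the
operator is `k - N + F`, where `F² ≤ N²` follows from `h₁` and `h₂` by interpolating with half the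
commutator and half the anticommutator of the observables of the first party. -/
theorem posSemidef_sub_bellOperator_sq {n : Type*} [Fintype n] [DecidableEq n]
    {A A' S D C : Matrix n n ℂ} (p q v k : ℝ)
    (hA : A.IsHermitian) (hA' : A'.IsHermitian) (hS : S.IsHermitian) (hD : D.IsHermitian)
    (hC : C.IsHermitian) (hAA : A * A = 1) (hAA' : A' * A' = 1) (hCC : C * C = 1)
    (hSD : D * D = (4 : ℝ) • 1 - S * S) (hDS : D * S = -(S * D))
    (hSA : S * A = A * S) (hSA' : S * A' = A' * S) (hDA : D * A = A * D) (hDA' : D * A' = A' * D)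
    (hCA : C * A = A * C) (hCA' : C * A' = A' * C) (hCS : C * S = S * C) (hCD : C * D = D * C)
    {N : Matrix n n ℂ}
    (hNdef : N = (k - 4 * v ^ 2) • 1 - p ^ 2 • (S * S) - q ^ 2 • (D * D)) (hN : N.PosDef)
    (h₁ : (N * N - (4 * p ^ 2) • (S * S * ((4 * v ^ 2) • 1 + q ^ 2 • (D * D)))).PosSemidef)
    (h₂ : (N * N - (16 * v ^ 2) • (p ^ 2 • (S * S) + q ^ 2 • (D * D))).PosSemidef) :
    (k • 1 - (p • (A * S) + (2 * v) • (A * C) + q • (A' * D)) *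
      (p • (A * S) + (2 * v) • (A * C) + q • (A' * D))).PosSemidef := by
  have aAA (x : Matrix n n ℂ) : A * (A * x) = x := by rw [← mul_assoc, hAA, one_mul]
  have aAA' (x : Matrix n n ℂ) : A' * (A' * x) = x := by rw [← mul_assoc, hAA', one_mul]
  have aCC (x : Matrix n n ℂ) : C * (C * x) = x := by rw [← mul_assoc, hCC, one_mul]
  have aSD (x : Matrix n n ℂ) : D * (D * x) = (4 : ℝ) • x - S * (S * x) := by
    rw [← mul_assoc, hSD, sub_mul, smul_mul_assoc, one_mul, mul_assoc]
  have aDS (x : Matrix n n ℂ) : D * (S * x) = -(S * (D * x)) := by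
    rw [← mul_assoc, hDS, neg_mul, mul_assoc]
  have swap {X Y : Matrix n n ℂ} (h : X * Y = Y * X) (x : Matrix n n ℂ) :
      X * (Y * x) = Y * (X * x) := by rw [← mul_assoc, h, mul_assoc]
  have aSA := swap hSA
  have aSA' := swap hSA'
  have aDA := swap hDA
  have aDA' := swap hDA'
  have aCA := swap hCA
  have aCA' := swap hCA'
  have aCS := swap hCS
  have aCD := swap hCD
  set T : Matrix n n ℂ := (1 / 2 : ℝ) • (A * A' + A' * A) with hT
  set K : Matrix n n ℂ := (1 / 2 : ℝ) • (A * A' - A' * A) with hK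
  set F : Matrix n n ℂ := (4 * p * v) • (S * C) + (2 * p * q) • (K * (S * D))
    + (4 * q * v) • (T * (C * D)) with hF
  have hTH : Tᴴ = T := by
    simp [hT, conjTranspose_smul, conjTranspose_mul, hA.eq, hA'.eq, add_comm]
  have hKH : Kᴴ = -K := by
    simp [hK, conjTranspose_smul, conjTranspose_mul, hA.eq, hA'.eq, ← smul_neg]
  have hFH : F.IsHermitian := by
    simp only [IsHermitian, hF, conjTranspose_add, conjTranspose_smul, conjTranspose_mul, hTH, hKH,
      hS.eq, hD.eq, hC.eq, star_trivial]
    simp only [hT, hK, mul_add, add_mul, mul_sub, sub_mul, smul_mul_assoc, mul_smul_comm, mul_assoc,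
      mul_neg, neg_mul, hSA, hSA', hDA, hDA', hCA, hCA', hCS, hCD, hDS,
      aSA, aSA', aDA, aDA', aCA, aCA', aCS, aCD, aDS]
    module
  have key : k • 1 - (p • (A * S) + (2 * v) • (A * C) + q • (A' * D)) *
      (p • (A * S) + (2 * v) • (A * C) + q • (A' * D)) = N - F := by
    simp only [hNdef, hF, hT, hK, mul_add, add_mul, mul_sub, sub_mul, smul_mul_assoc, mul_smul_comm,
      mul_assoc, mul_neg, neg_mul, hSA, hSA', hDA, hDA', hCA, hCA', hCS, hCD, hDS, hAA, hAA', hCC,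
      hSD, aSA, aSA', aDA, aDA', aCA, aCA', aCS, aCD, aDS, aAA, aAA', aCC, aSD, mul_one, one_mul]
    module
  rw [key]
  refine hN.posSemidef_sub_of_sq hFH ?_ ?_
  · rw [Commute, SemiconjBy]
    simp only [hNdef, hF, hT, hK, mul_add, add_mul, mul_sub, sub_mul, smul_mul_assoc, mul_smul_comm,
      mul_assoc, mul_neg, neg_mul, hSA, hSA', hDA, hDA', hCA, hCA', hCS, hCD, hDS, hAA, hAA', hCC,
      hSD, aSA, aSA', aDA, aDA', aCA, aCA', aCS, aCD, aDS, aAA, aAA', aCC, aSD, mul_one, one_mul]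
    module
  · convert (h₁.conjTranspose_mul_mul_same K).add (h₂.conjTranspose_mul_mul_same T) using 1
    rw [hTH, hKH]
    simp only [hNdef, hF, hT, hK, mul_add, add_mul, mul_sub, sub_mul, smul_mul_assoc, mul_smul_comm,
      mul_assoc, mul_neg, neg_mul, hSA, hSA', hDA, hDA', hCA, hCA', hCS, hCD, hDS, hAA, hAA', hCC,
      hSD, aSA, aSA', aDA, aDA', aCA, aCA', aCS, aCD, aDS, aAA, aAA', aCC, aSD, mul_one, one_mul]
    module

open Matrix in
/-- Operator bound when `C` is paired with the observable of weight `α`. -/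
theorem posSemidef_sub_tiltedBell_sq_left {n : Type*} [Fintype n] [DecidableEq n]
    {A A' S D C : Matrix n n ℂ} {α u v : ℝ} (hα : 1 ≤ α) (huv : 0 < u ^ 2 + v ^ 2)
    (hA : A.IsHermitian) (hA' : A'.IsHermitian) (hS : S.IsHermitian) (hD : D.IsHermitian)
    (hC : C.IsHermitian) (hAA : A * A = 1) (hAA' : A' * A' = 1) (hCC : C * C = 1)
    (hSD : D * D = (4 : ℝ) • 1 - S * S) (hDS : D * S = -(S * D))
    (hSA : S * A = A * S) (hSA' : S * A' = A' * S) (hDA : D * A = A * D) (hDA' : D * A' = A' * D)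
    (hCA : C * A = A * C) (hCA' : C * A' = A' * C) (hCS : C * S = S * C) (hCD : C * D = D * C) :
    ((4 * (1 + α ^ 2) * (u ^ 2 + v ^ 2)) • 1 -
      ((α * u) • (A * S) + (2 * v) • (A * C) + u • (A' * D)) *
      ((α * u) • (A * S) + (2 * v) • (A * C) + u • (A' * D))).PosSemidef := by
  have hα2 : 0 ≤ α ^ 2 - 1 := by nlinarith
  have hD2 : (D * D).PosSemidef := by simpa [hD.eq] using posSemidef_conjTranspose_mul_self D
  have hD4 : (D * D * (D * D)).PosSemidef := by
    simpa [hD.eq] using posSemidef_conjTranspose_mul_self (D * D)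
  refine posSemidef_sub_bellOperator_sq (α * u) u v _ hA hA' hS hD hC hAA hAA' hCC hSD hDS
    hSA hSA' hDA hDA' hCA hCA' hCS hCD rfl ?_ ?_ ?_
  · have hc : 0 < 4 * u ^ 2 + 4 * α ^ 2 * v ^ 2 := by
      nlinarith [mul_nonneg hα2 (sq_nonneg v)]
    have hr : 0 ≤ u ^ 2 * (α ^ 2 - 1) := by positivity
    convert ((PosDef.one (n := n) (R := ℂ)).smul hc).add_posSemidef (hD2.smul hr) using 1
    rw [hSD]
    module
  · have hZ : (u ^ 2 • (S * S) - α ^ 2 • ((4 * v ^ 2) • 1 + u ^ 2 • (D * D))).IsHermitian := by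
      simp [IsHermitian, hS.eq, hD.eq]
    convert posSemidef_conjTranspose_mul_self
      (u ^ 2 • (S * S) - α ^ 2 • ((4 * v ^ 2) • 1 + u ^ 2 • (D * D))) using 1
    rw [hZ.eq]
    simp only [mul_add, add_mul, mul_sub, sub_mul, smul_mul_assoc, mul_smul_comm, mul_assoc,
      hSD, mul_one, one_mul]
    module
  · have h0 : 0 ≤ 16 * (u ^ 2 - α ^ 2 * v ^ 2) ^ 2 := by positivity
    have h1 : 0 ≤ u ^ 2 * (α ^ 2 - 1) * (8 * u ^ 2 + 8 * α ^ 2 * v ^ 2 + 16 * v ^ 2) := by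
      positivity
    have h2 : 0 ≤ (u ^ 2 * (α ^ 2 - 1)) ^ 2 := by positivity
    convert (((PosSemidef.one (n := n) (R := ℂ)).smul h0).add (hD2.smul h1)).add (hD4.smul h2)
      using 1
    simp only [mul_add, add_mul, mul_sub, sub_mul, smul_mul_assoc, mul_smul_comm, mul_assoc,
      hSD, mul_one, one_mul]
    module

open Matrix in
/-- Operator bound when `C` is paired with the observable of weight `1`. -/
theorem posSemidef_sub_tiltedBell_sq_right {n : Type*} [Fintype n] [DecidableEq n]
    {A A' S D C : Matrix n n ℂ} {α u v : ℝ} (hα : 1 ≤ α) (huv : 0 < u ^ 2 + v ^ 2)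
    (hA : A.IsHermitian) (hA' : A'.IsHermitian) (hS : S.IsHermitian) (hD : D.IsHermitian)
    (hC : C.IsHermitian) (hAA : A * A = 1) (hAA' : A' * A' = 1) (hCC : C * C = 1)
    (hSD : D * D = (4 : ℝ) • 1 - S * S) (hDS : D * S = -(S * D))
    (hSA : S * A = A * S) (hSA' : S * A' = A' * S) (hDA : D * A = A * D) (hDA' : D * A' = A' * D)
    (hCA : C * A = A * C) (hCA' : C * A' = A' * C) (hCS : C * S = S * C) (hCD : C * D = D * C) :
    ((4 * (1 + α ^ 2) * (u ^ 2 + v ^ 2)) • 1 -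
      (u • (A * S) + (2 * v) • (A * C) + (α * u) • (A' * D)) *
      (u • (A * S) + (2 * v) • (A * C) + (α * u) • (A' * D))).PosSemidef := by
  have hα2 : 0 ≤ α ^ 2 - 1 := by nlinarith
  have hS2 : (S * S).PosSemidef := by simpa [hS.eq] using posSemidef_conjTranspose_mul_self S
  have hS4 : (S * S * (S * S)).PosSemidef := by
    simpa [hS.eq] using posSemidef_conjTranspose_mul_self (S * S)
  refine posSemidef_sub_bellOperator_sq u (α * u) v _ hA hA' hS hD hC hAA hAA' hCC hSD hDS
    hSA hSA' hDA hDA' hCA hCA' hCS hCD rfl ?_ ?_ ?_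
  · have hc : 0 < 4 * u ^ 2 + 4 * α ^ 2 * v ^ 2 := by
      nlinarith [mul_nonneg hα2 (sq_nonneg v)]
    have hr : 0 ≤ u ^ 2 * (α ^ 2 - 1) := by positivity
    convert ((PosDef.one (n := n) (R := ℂ)).smul hc).add_posSemidef (hS2.smul hr) using 1
    rw [hSD]
    module
  · have hc : 0 ≤ 64 * v ^ 2 * (α ^ 2 - 1) * (u ^ 2 + v ^ 2) := by positivity
    set Z : Matrix n n ℂ := (4 * α ^ 2 * (u ^ 2 + v ^ 2) - 8 * v ^ 2) • 1
      - ((α ^ 2 + 1) * u ^ 2) • (D * D) with hZdef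
    have hZ : Z.IsHermitian := by
      simp [hZdef, IsHermitian, hD.eq]
    convert (posSemidef_conjTranspose_mul_self Z).add
      ((PosSemidef.one (n := n) (R := ℂ)).smul hc) using 1
    rw [hZ.eq, hZdef]
    simp only [mul_add, add_mul, mul_sub, sub_mul, smul_mul_assoc, mul_smul_comm, mul_assoc,
      hSD, mul_one, one_mul]
    module
  · have h0 : 0 ≤ 16 * (u ^ 2 - α ^ 2 * v ^ 2) ^ 2 := by positivity
    have h1 : 0 ≤ u ^ 2 * (α ^ 2 - 1) * (8 * u ^ 2 + 8 * α ^ 2 * v ^ 2 + 16 * v ^ 2) := by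
      positivity
    have h2 : 0 ≤ (u ^ 2 * (α ^ 2 - 1)) ^ 2 := by positivity
    convert (((PosSemidef.one (n := n) (R := ℂ)).smul h0).add (hS2.smul h1)).add (hS4.smul h2)
      using 1
    simp only [mul_add, add_mul, mul_sub, sub_mul, smul_mul_assoc, mul_smul_comm, mul_assoc,
      hSD, mul_one, one_mul]
    module

open Matrix in
/-- If `M² ≤ κ` as operators, then `⟨M⟩² ≤ κ` in every state. -/
theorem sq_re_trace_mul_le {n : Type*} [Fintype n] [DecidableEq n] {ρ M : Matrix n n ℂ} {κ : ℝ}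
    (hρ : ρ.PosSemidef) (hTr : ρ.trace = 1) (hM : M.IsHermitian)
    (h : (κ • 1 - M * M).PosSemidef) : (ρ * M).trace.re ^ 2 ≤ κ := by
  set t := (ρ * M).trace.re with ht
  have h1 := hρ.re_trace_mul_nonneg h
  have h2 := hρ.re_trace_mul_nonneg (posSemidef_conjTranspose_mul_self (M - t • 1))
  have hH : (M - t • (1 : Matrix n n ℂ)).IsHermitian := by simp [IsHermitian, hM.eq]
  rw [hH.eq] at h2
  simp only [mul_sub, sub_mul, mul_smul_comm, smul_mul_assoc, mul_one, one_mul, trace_sub,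
    trace_smul, Complex.sub_re, Complex.real_smul, Complex.re_ofReal_mul, hTr, Complex.ofReal_re,
    ← ht] at h1 h2
  nlinarith

/-- For every `α ≥ 1`, every `i, j ∈ {1,2}`, and every tripartite quantum
state `ρ` with `±1`-valued local observables `A_1, A_2, B_1, B_2, C_1, C_2`:
`(Ĩ^α_{AB})² + 4·⟨A_iC_j⟩² ≤ 4·(1 + α²)`. -/
theorem quantum_monogamy_single_correlator
    (nA nB nC : ℕ) (hA : 0 < nA) (hB : 0 < nB) (hC : 0 < nC)
    (α : ℝ) (hα : 1 ≤ α)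
    (ρ : Matrix ((Fin nA × Fin nB) × Fin nC) ((Fin nA × Fin nB) × Fin nC) ℂ)
    (hρ : ρ.PosSemidef) (hTr : ρ.trace = 1)
    (A : Fin 2 → Matrix (Fin nA) (Fin nA) ℂ)
    (B : Fin 2 → Matrix (Fin nB) (Fin nB) ℂ)
    (C : Fin 2 → Matrix (Fin nC) (Fin nC) ℂ)
    (hAh : ∀ i, (A i).IsHermitian) (hAu : ∀ i, A i * A i = 1)
    (hBh : ∀ i, (B i).IsHermitian) (hBu : ∀ i, B i * B i = 1)
    (hCh : ∀ i, (C i).IsHermitian) (hCu : ∀ i, C i * C i = 1)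
    (i j : Fin 2) :
    (tiltedCHSH α fun i' j' => corrAB ρ (A i') (B j')) ^ 2
      + 4 * (corrAC ρ (A i) (C j)) ^ 2 ≤ 4 * (1 + α ^ 2) := by
  set A' : Fin 2 → Matrix ((Fin nA × Fin nB) × Fin nC) ((Fin nA × Fin nB) × Fin nC) ℂ :=
    fun i => (A i ⊗ₖ 1) ⊗ₖ 1 with hA'
  set B' : Fin 2 → Matrix ((Fin nA × Fin nB) × Fin nC) ((Fin nA × Fin nB) × Fin nC) ℂ :=
    fun i => (1 ⊗ₖ B i) ⊗ₖ 1 with hB'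
  set C' : Matrix ((Fin nA × Fin nB) × Fin nC) ((Fin nA × Fin nB) × Fin nC) ℂ :=
    (1 ⊗ₖ 1) ⊗ₖ C j with hC'
  have hAh' (i) : (A' i).IsHermitian := by
    simp [hA', Matrix.IsHermitian, Matrix.conjTranspose_kronecker, (hAh i).eq]
  have hBh' (i) : (B' i).IsHermitian := by
    simp [hB', Matrix.IsHermitian, Matrix.conjTranspose_kronecker, (hBh i).eq]
  have hCh' : C'.IsHermitian := by
    simp [hC', Matrix.IsHermitian, Matrix.conjTranspose_kronecker, (hCh j).eq]
  have hAu' (i) : A' i * A' i = 1 := by simp [hA', ← Matrix.mul_kronecker_mul, hAu]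
  have hBu' (i) : B' i * B' i = 1 := by simp [hB', ← Matrix.mul_kronecker_mul, hBu]
  have hCu' : C' * C' = 1 := by simp [hC', ← Matrix.mul_kronecker_mul, hCu]
  have hBA (k l) : B' k * A' l = A' l * B' k := by simp [hA', hB', ← Matrix.mul_kronecker_mul]
  have hCA (l) : C' * A' l = A' l * C' := by simp [hA', hC', ← Matrix.mul_kronecker_mul]
  have hCB (k) : C' * B' k = B' k * C' := by simp [hB', hC', ← Matrix.mul_kronecker_mul]
  have hAB (k l) : corrAB ρ (A k) (B l) = (ρ * (A' k * B' l)).trace.re := by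
    simp [corrAB, hA', hB', ← Matrix.mul_kronecker_mul]
  have hAC : corrAC ρ (A i) (C j) = (ρ * (A' i * C')).trace.re := by
    simp [corrAC, hA', hC', ← Matrix.mul_kronecker_mul]
  set u := tiltedCHSH α fun i' j' => corrAB ρ (A i') (B j') with hu
  set w := corrAC ρ (A i) (C j) with hw
  rcases (show 0 ≤ u ^ 2 + (2 * w) ^ 2 by positivity).eq_or_lt with h0 | hpos
  · nlinarith [sq_nonneg α]
  have hherm {X Y : Matrix ((Fin nA × Fin nB) × Fin nC) ((Fin nA × Fin nB) × Fin nC) ℂ}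
      (hX : X.IsHermitian) (hY : Y.IsHermitian) (h : Y * X = X * Y) (r : ℝ) :
      (r • (X * Y)).IsHermitian := by
    simp [Matrix.IsHermitian, hX.eq, hY.eq, h]
  have hS := (hBh' 0).add (hBh' 1)
  have hD := (hBh' 0).sub (hBh' 1)
  have hSA (l) : (B' 0 + B' 1) * A' l = A' l * (B' 0 + B' 1) := by
    simp only [add_mul, mul_add, hBA]
  have hDA (l) : (B' 0 - B' 1) * A' l = A' l * (B' 0 - B' 1) := by
    simp only [sub_mul, mul_sub, hBA]
  have hCS : C' * (B' 0 + B' 1) = (B' 0 + B' 1) * C' := by simp only [add_mul, mul_add, hCB]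
  have hCD : C' * (B' 0 - B' 1) = (B' 0 - B' 1) * C' := by simp only [sub_mul, mul_sub, hCB]
  have hDD : (B' 0 - B' 1) * (B' 0 - B' 1) = (4 : ℝ) • 1 - (B' 0 + B' 1) * (B' 0 + B' 1) := by
    simp only [sub_mul, mul_sub, add_mul, mul_add, hBu']
    module
  have hDS : (B' 0 - B' 1) * (B' 0 + B' 1) = -((B' 0 + B' 1) * (B' 0 - B' 1)) := by
    simp only [sub_mul, mul_sub, add_mul, mul_add, hBu']
    module
  suffices (u ^ 2 + (2 * w) ^ 2) ^ 2 ≤ 4 * (1 + α ^ 2) * (u ^ 2 + (2 * w) ^ 2) by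
    rw [sq (u ^ 2 + (2 * w) ^ 2)] at this
    linarith [le_of_mul_le_mul_right this hpos]
  fin_cases i
  · have h := sq_re_trace_mul_le hρ hTr
      (((hherm (hAh' 0) hS (hSA 0) _).add (hherm (hAh' 0) hCh' (hCA 0) _)).add
        (hherm (hAh' 1) hD (hDA 1) _))
      (posSemidef_sub_tiltedBell_sq_left hα hpos (hAh' 0) (hAh' 1) hS hD hCh' (hAu' 0) (hAu' 1)
        hCu' hDD hDS (hSA 0) (hSA 1) (hDA 0) (hDA 1) (hCA 0) (hCA 1) hCS hCD)
    convert h using 2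
    simp only [tiltedCHSH, hAB] at hu
    simp only [Fin.zero_eta] at hAC
    simp only [mul_add, mul_sub, smul_add, smul_sub, mul_smul_comm, Matrix.trace_add,
      Matrix.trace_sub, Matrix.trace_smul, Complex.add_re, Complex.sub_re, Complex.real_smul,
      Complex.re_ofReal_mul, ← hAC]
    linear_combination u * hu
  · have h := sq_re_trace_mul_le hρ hTr
      (((hherm (hAh' 1) hD (hDA 1) _).add (hherm (hAh' 1) hCh' (hCA 1) _)).add
        (hherm (hAh' 0) hS (hSA 0) _))
      (posSemidef_sub_tiltedBell_sq_right hα hpos (hAh' 1) (hAh' 0) hD hS hCh' (hAu' 1) (hAu' 0)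
        hCu' (by rw [hDD]; abel) (by rw [hDS, neg_neg]) (hDA 1) (hDA 0) (hSA 1) (hSA 0)
        (hCA 1) (hCA 0) hCD hCS)
    convert h using 2
    simp only [tiltedCHSH, hAB] at hu
    simp only [Fin.mk_one] at hAC
    simp only [mul_add, mul_sub, smul_add, smul_sub, mul_smul_comm, Matrix.trace_add,
      Matrix.trace_sub, Matrix.trace_smul, Complex.add_re, Complex.sub_re, Complex.real_smul,
      Complex.re_ofReal_mul, ← hAC]
    linear_combination u * hu
end

section
/- Let N ≥ 2 be an integer, λ > 0 a real constant, and ε ∈ [0, 1/2). The sequence r ↦ ((1+2ε)/(1−2ε))^{1+(N−1)·r} · λ · 2^{−(r−1)} (r ranging over the positive integers) converges to 0 as r → ∞ if and only if ε < (2^{1/(N−1)} − 1)/(2·(2^{1/(N−1)} + 1)); in particular, for N = 2 the threshold equals 1/6. -/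
/-- The geometric sequence `q ^ (1 + n r) c / 2 ^ (r - 1)` tends to `0` iff `q ^ n < 2`. -/
theorem tendsto_pow_mul_div_two_pow_iff {q : ℝ} (hq : 0 < q) (n : ℕ) {c : ℝ} (hc : 0 < c) :
    Filter.Tendsto (fun r : ℕ => q ^ (1 + n * r) * c / 2 ^ (r - 1)) Filter.atTop (nhds 0)
      ↔ q ^ n < 2 := by
  have hC : q ^ (1 + n) * c ≠ 0 := by positivity
  have hshift : (fun r : ℕ => q ^ (1 + n * (r + 1)) * c / 2 ^ (r + 1 - 1))
      = fun r : ℕ => q ^ (1 + n) * c * (q ^ n / 2) ^ r := by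
    funext r
    rw [Nat.add_sub_cancel, div_pow, ← pow_mul]
    ring
  rw [← Filter.tendsto_add_atTop_iff_nat 1, hshift]
  have hscale : Filter.Tendsto (fun r : ℕ => q ^ (1 + n) * c * (q ^ n / 2) ^ r)
      Filter.atTop (nhds 0) ↔ Filter.Tendsto (fun r : ℕ => (q ^ n / 2) ^ r)
      Filter.atTop (nhds 0) := by
    refine ⟨fun h => ?_, fun h => by simpa using h.const_mul (q ^ (1 + n) * c)⟩
    simpa only [inv_mul_cancel_left₀ hC, mul_zero] using h.const_mul (q ^ (1 + n) * c)⁻¹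
  rw [hscale, tendsto_pow_atTop_nhds_zero_iff, abs_of_pos (by positivity),
    div_lt_one (by norm_num)]

/-- Inverting the Möbius map `ε ↦ (1 + 2ε) / (1 - 2ε)`. -/
theorem lt_bias_threshold_iff {t ε : ℝ} (ht : 0 < t) (hε : ε < 1 / 2) :
    ε < (t - 1) / (2 * (t + 1)) ↔ (1 + 2 * ε) / (1 - 2 * ε) < t := by
  rw [lt_div_iff₀ (by positivity), div_lt_iff₀ (by linarith)]
  constructor <;> intro h <;> linarith


/-- Let `N ≥ 2` be an integer, `λ > 0` real, and `ε ∈ [0, 1/2)`.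
The sequence `r ↦ ((1+2ε)/(1−2ε))^{1+(N−1)·r} · λ · 2^{−(r−1)}` (over positive integers
`r`) converges to `0` as `r → ∞` if and only if
`ε < (2^{1/(N−1)} − 1)/(2·(2^{1/(N−1)} + 1))`; in particular for `N = 2` the threshold
equals `1/6`. -/
theorem improved_randomness_amplification_threshold
    (N : ℕ) (hN : 2 ≤ N) (lam : ℝ) (hlam : 0 < lam) (ε : ℝ) (hε0 : 0 ≤ ε) (hε1 : ε < 1 / 2) :
    (Filter.Tendsto
        (fun r : ℕ => ((1 + 2 * ε) / (1 - 2 * ε)) ^ (1 + (N - 1) * r) * lam / 2 ^ (r - 1))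
        Filter.atTop (nhds 0)
      ↔ ε < ((2 : ℝ) ^ ((1 : ℝ) / ((N : ℝ) - 1)) - 1)
          / (2 * ((2 : ℝ) ^ ((1 : ℝ) / ((N : ℝ) - 1)) + 1)))
    ∧ ((2 : ℝ) ^ ((1 : ℝ) / ((2 : ℝ) - 1)) - 1)
          / (2 * ((2 : ℝ) ^ ((1 : ℝ) / ((2 : ℝ) - 1)) + 1)) = 1 / 6 := by
  refine ⟨?_, by norm_num⟩
  obtain ⟨n, rfl⟩ : ∃ n, N = n + 1 := ⟨N - 1, by omega⟩
  have hn : n ≠ 0 := by omega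
  have hden : 0 < 1 - 2 * ε := by linarith
  have hq : 0 < (1 + 2 * ε) / (1 - 2 * ε) := by positivity
  have hcast : ((n + 1 : ℕ) : ℝ) - 1 = n := by push_cast; ring
  rw [hcast, Nat.add_sub_cancel, one_div (n : ℝ), lt_bias_threshold_iff (by positivity) hε1,
    ← pow_lt_pow_iff_left₀ hq.le (by positivity) hn, Real.rpow_inv_natCast_pow (by norm_num) hn]
  exact tendsto_pow_mul_div_two_pow_iff hq n hlam
end
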